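/- Pressure-work identity under the PDE closure (the computation producing the extra relaxation term in estimate (3.6)). Let d ≥ 1, γ₊, γ₋ > 1 and μ̄ > 0. Let α₊, α₋, ρ₊, ρ₋ : ℝ × ℝ^d → ℝ and u : ℝ × ℝ^d → ℝ^d be smooth ℤ^d-periodic functions with ρ₊ > 0, ρ₋ > 0, satisfying: α₊ + α₋ = 1; the mass equations ∂ₜ(α±ρ±) + div(α±ρ±u) = 0 for both phases; and the PDE closure ∂ₜα₊ + u·∇α₊ = (1/μ̄)α₊α₋(ρ₊^{γ₊} − ρ₋^{γ₋}). Then for every time t: ∫_{[0,1]^d} ∇(α₊ρ₊^{γ₊} + α₋ρ₋^{γ₋})·u dx = ∫_{[0,1]^d} (1/μ̄)α₊α₋(ρ₊^{γ₊} − ρ₋^{γ₋})² dx + d/dt ∫_{[0,1]^d} [ α₊ρ₊^{γ₊}/(γ₊−1) + α₋ρ₋^{γ₋}/(γ₋−1) ] dx. -/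

import Mathlib

open MeasureTheory Real

noncomputable section

/-- A space–time point: time in `ℝ`, space in `ℝ^d`. -/
abbrev Pt (d : ℕ) := ℝ × (Fin d → ℝ)

/-- Time derivative `∂ₜ f`. -/
def pt {d : ℕ} (f : Pt d → ℝ) (p : Pt d) : ℝ :=
  fderiv ℝ f p (1, 0)

/-- Spatial partial derivative `∂_{x i} f`. -/
def pd {d : ℕ} (i : Fin d) (f : Pt d → ℝ) (p : Pt d) : ℝ :=
  fderiv ℝ f p (0, Pi.single i 1)

/-- Spatial divergence of a vector field. -/
def divg {d : ℕ} (u : Pt d → Fin d → ℝ) (p : Pt d) : ℝ :=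
  ∑ i, pd i (fun q => u q i) p

/-- Spatial Laplacian of a scalar function. -/
def lap {d : ℕ} (f : Pt d → ℝ) (p : Pt d) : ℝ :=
  ∑ i, pd i (fun q => pd i f q) p

/-- `i`-th component of `div (r u ⊗ u)`, i.e. `∑ j ∂_{x j} (r u_i u_j)`. -/
def divT {d : ℕ} (r : Pt d → ℝ) (u : Pt d → Fin d → ℝ) (p : Pt d) (i : Fin d) : ℝ :=
  ∑ j, pd j (fun q => r q * u q i * u q j) p

/-- Symmetric gradient `D(u) = (∇u + (∇u)ᵀ)/2`. -/
def Dsym {d : ℕ} (u : Pt d → Fin d → ℝ) (p : Pt d) (i j : Fin d) : ℝ :=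
  (pd j (fun q => u q i) p + pd i (fun q => u q j) p) / 2

/-- Divergence of a matrix field, `i`-th component `∑ j ∂_{x j} M_{ij}`. -/
def divM {d : ℕ} (M : Pt d → Fin d → Fin d → ℝ) (p : Pt d) (i : Fin d) : ℝ :=
  ∑ j, pd j (fun q => M q i j) p

/-- `ℤ^d`-periodicity in the space variable. -/
def ZPeriodic {d : ℕ} (f : Pt d → ℝ) : Prop :=
  ∀ (k : Fin d → ℤ) (t : ℝ) (x : Fin d → ℝ), f (t, x + fun i => (k i : ℝ)) = f (t, x)

/-- `ℤ^d`-periodicity of a vector field. -/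
def ZPeriodicVec {d : ℕ} (u : Pt d → Fin d → ℝ) : Prop :=
  ∀ i, ZPeriodic (fun q => u q i)

/-- The unit cell `[0,1]^d`. -/
def cell (d : ℕ) : Set (Fin d → ℝ) := Set.Icc 0 1

theorem ContDiff.continuous_fderiv_apply_const {d : ℕ} {f : Pt d → ℝ}
    (hf : ContDiff ℝ 1 f) (v : Pt d) : Continuous fun p => fderiv ℝ f p v :=
  (hf.continuous_fderiv one_ne_zero).clm_apply continuous_const

theorem isCompact_cell (d : ℕ) : IsCompact (cell d) := isCompact_Icc

theorem Continuous.integrableOn_cell {d : ℕ} {f : Pt d → ℝ} (hf : Continuous f) (t : ℝ) :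
    IntegrableOn (fun x => f (t, x)) (cell d) :=
  (hf.comp (by fun_prop)).continuousOn.integrableOn_compact (isCompact_cell d)

/-- Contracting the spatial gradient with `v` gives the derivative in direction `(0, v)`. -/
theorem sum_pd_mul {d : ℕ} (f : Pt d → ℝ) (p : Pt d) (v : Fin d → ℝ) :
    ∑ i, pd i f p * v i = fderiv ℝ f p (0, v) := by
  have hv : ((0, v) : Pt d) = ∑ i, v i • ((0, Pi.single i 1) : Pt d) := by
    ext j
    · simp [Prod.fst_sum]
    · simp [Prod.snd_sum, Finset.sum_apply, Pi.single_apply]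
  rw [hv, map_sum]
  exact Finset.sum_congr rfl fun i _ => by rw [map_smul, smul_eq_mul, pd, mul_comm]

/-- The material derivative is the derivative in direction `(1, v)`. -/
theorem pt_add_sum_pd_mul {d : ℕ} (f : Pt d → ℝ) (p : Pt d) (v : Fin d → ℝ) :
    pt f p + ∑ i, pd i f p * v i = fderiv ℝ f p (1, v) := by
  rw [sum_pd_mul, pt, ← map_add]
  simp

theorem divg_mul {d : ℕ} {f : Pt d → ℝ} {u : Pt d → Fin d → ℝ} {p : Pt d}
    (hf : DifferentiableAt ℝ f p) (hu : DifferentiableAt ℝ u p) :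
    divg (fun q j => f q * u q j) p = fderiv ℝ f p (0, u p) + f p * divg u p := by
  rw [← sum_pd_mul, divg, divg, Finset.mul_sum, ← Finset.sum_add_distrib]
  refine Finset.sum_congr rfl fun i _ => ?_
  have hui : DifferentiableAt ℝ (fun q => u q i) p := differentiableAt_pi.1 hu i
  simp only [pd]
  rw [fderiv_fun_mul hf hui]
  simp only [add_apply, smul_apply, smul_eq_mul]
  ring

theorem pt_add_divg_mul {d : ℕ} {f : Pt d → ℝ} {u : Pt d → Fin d → ℝ} {p : Pt d}
    (hf : DifferentiableAt ℝ f p) (hu : DifferentiableAt ℝ u p) :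
    pt f p + divg (fun q j => f q * u q j) p = fderiv ℝ f p (1, u p) + f p * divg u p := by
  rw [divg_mul hf hu, ← add_assoc, ← pt_add_sum_pd_mul, sum_pd_mul]

/-- Balance of the barotropic internal energy of a single phase with volume fraction `α` and
density `ρ`. -/
theorem energy_balance {d : ℕ} {γ : ℝ} (hγ : γ ≠ 1) {α ρ : Pt d → ℝ} {u : Pt d → Fin d → ℝ}
    {p : Pt d} (hα : DifferentiableAt ℝ α p) (hρ : DifferentiableAt ℝ ρ p)
    (hu : DifferentiableAt ℝ u p) (hpos : 0 < ρ p)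
    (hmass : pt (fun q => α q * ρ q) p + divg (fun q j => α q * ρ q * u q j) p = 0) :
    fderiv ℝ (fun q => α q * ρ q ^ γ / (γ - 1)) p (1, u p)
        + α p * ρ p ^ γ / (γ - 1) * divg u p
      = -(ρ p ^ γ * fderiv ℝ α p (1, u p)) - α p * ρ p ^ γ * divg u p := by
  have hγ' : γ - 1 ≠ 0 := sub_ne_zero.2 hγ
  rw [pt_add_divg_mul (hα.fun_mul hρ) hu, fderiv_fun_mul hα hρ] at hmass
  have hE := ((hα.hasFDerivAt.fun_mul
    (hρ.hasFDerivAt.rpow_const (p := γ) (Or.inl hpos.ne'))).mul_const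
    (γ - 1)⁻¹).fderiv
  simp only [← div_eq_mul_inv] at hE
  rw [hE]
  have hpow : ρ p ^ γ = ρ p ^ (γ - 1) * ρ p := by
    rw [← Real.rpow_add_one hpos.ne', sub_add_cancel]
  simp only [add_apply, smul_apply, smul_eq_mul] at hmass ⊢
  rw [hpow]
  field_simp
  linear_combination γ * hmass

/-- The integral over the unit cell of the divergence of a periodic field vanishes. -/
theorem integral_divg_eq_zero {d : ℕ} {F : Pt d → Fin d → ℝ} (hF : ContDiff ℝ 1 F)
    (hper : ZPeriodicVec F) (t : ℝ) : ∫ x in cell d, divg F (t, x) = 0 := by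
  cases d with
  | zero => simp [divg]
  | succ n =>
    have hFi : ∀ i, ContDiff ℝ 1 (fun q => F q i) := contDiff_pi.1 hF
    have hd : ∀ i x, HasFDerivAt (fun y => F (t, y) i)
        ((fderiv ℝ (fun q => F q i) (t, x)).comp
          (ContinuousLinearMap.inr ℝ ℝ (Fin (n + 1) → ℝ))) x := fun i x =>
      HasFDerivAt.comp x (((hFi i).differentiable one_ne_zero) (t, x)).hasFDerivAt
        (hasFDerivAt_prodMk_right t x)
    have hcont : Continuous fun p => divg F p :=
      continuous_finsetSum _ fun i _ => (hFi i).continuous_fderiv_apply_const _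
    have key := integral_divergence_of_hasFDerivAt_off_countable' (0 : Fin (n + 1) → ℝ) 1
      zero_le_one (fun i x => F (t, x) i) _ ∅ Set.countable_empty
      (fun i => ((hFi i).continuous.comp (by fun_prop)).continuousOn)
      (fun x _ i => hd i x) (hcont.integrableOn_cell t)
    refine Eq.trans ?_ (key.trans (Finset.sum_eq_zero fun i _ => ?_))
    · rfl
    · rw [sub_eq_zero]
      congr 1
      ext x
      have h := hper i (Pi.single i 1) t (i.insertNth 0 x)
      refine Eq.trans (congrArg (fun q => F q i) ?_) h
      refine Prod.ext rfl (funext fun j => ?_)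
      refine Fin.succAboveCases i ?_ (fun k => ?_) j <;> simp

/-- Differentiation under the integral over the unit cell. -/
theorem hasDerivAt_integral_cell {d : ℕ} {f : Pt d → ℝ} (hf : ContDiff ℝ 1 f) (t : ℝ) :
    HasDerivAt (fun s => ∫ x in cell d, f (s, x)) (∫ x in cell d, pt f (t, x)) t := by
  have hc : Continuous (pt f) := hf.continuous_fderiv_apply_const _
  obtain ⟨C, hC⟩ := ((isCompact_Icc (a := t - 1) (b := t + 1)).prod
    (isCompact_cell d)).exists_bound_of_continuousOn hc.continuousOn
  have hms : MeasurableSet (cell d) := measurableSet_Icc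
  refine (hasDerivAt_integral_of_dominated_loc_of_deriv_le (bound := fun _ => C)
    (F' := fun s x => pt f (s, x))
    (Icc_mem_nhds (sub_one_lt t) (lt_add_one t))
    (Filter.Eventually.of_forall fun s => (hf.continuous.integrableOn_cell s).1)
    (hf.continuous.integrableOn_cell t) (hc.integrableOn_cell t).1 ?_
    (continuous_const.integrableOn_cell t) ?_).2
  · exact (ae_restrict_iff' hms).2 (Filter.Eventually.of_forall fun x hx s hs => hC (s, x) ⟨hs, hx⟩)
  · refine Filter.Eventually.of_forall fun x s _ => ?_
    have h := (((hf.differentiable one_ne_zero) (s, x)).hasFDerivAt).comp_hasDerivAt s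
      ((hasDerivAt_id s).prodMk (hasDerivAt_const s x))
    exact h

/-- pressure-work identity under the PDE closure (the computation
producing the extra relaxation term in estimate (3.6)). -/
theorem pressure_work_identity_PDE_closure
    {d : ℕ} (hd : 1 ≤ d) (γp γm μbar : ℝ) (hγp : 1 < γp) (hγm : 1 < γm)
    (hμbar : 0 < μbar)
    (αp αm ρp ρm : Pt d → ℝ) (u : Pt d → Fin d → ℝ)
    (hreg : ContDiff ℝ (⊤ : ℕ∞) αp ∧ ContDiff ℝ (⊤ : ℕ∞) αm ∧ ContDiff ℝ (⊤ : ℕ∞) ρp ∧ ContDiff ℝ (⊤ : ℕ∞) ρm ∧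
      ContDiff ℝ (⊤ : ℕ∞) u)
    (hper : ZPeriodic αp ∧ ZPeriodic αm ∧ ZPeriodic ρp ∧ ZPeriodic ρm ∧ ZPeriodicVec u)
    (hρp : ∀ p, 0 < ρp p) (hρm : ∀ p, 0 < ρm p)
    (hα : ∀ p, αp p + αm p = 1)
    (hmassp : ∀ p, pt (fun q => αp q * ρp q) p
      + divg (fun q j => αp q * ρp q * u q j) p = 0)
    (hmassm : ∀ p, pt (fun q => αm q * ρm q) p
      + divg (fun q j => αm q * ρm q * u q j) p = 0)
    (hclosure : ∀ p : Pt d, pt αp p + ∑ i, u p i * pd i αp p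
      = (1 / μbar) * (αp p * αm p) * (ρp p ^ γp - ρm p ^ γm)) :
    ∀ t : ℝ,
      (∫ x in cell d,
          ∑ i, pd i (fun q => αp q * ρp q ^ γp + αm q * ρm q ^ γm) (t, x) * u (t, x) i)
      = (∫ x in cell d, (1 / μbar) * (αp (t, x) * αm (t, x))
            * (ρp (t, x) ^ γp - ρm (t, x) ^ γm) ^ 2)
        + deriv (fun s => ∫ x in cell d,
            (αp (s, x) * ρp (s, x) ^ γp / (γp - 1)
              + αm (s, x) * ρm (s, x) ^ γm / (γm - 1))) t := by
  obtain ⟨hαp, hαm, hρp', hρm', hu⟩ := hreg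
  obtain ⟨pαp, pαm, pρp, pρm, pu⟩ := hper
  intro t
  have one_le : (1 : WithTop ℕ∞) ≤ ((⊤ : ℕ∞) : WithTop ℕ∞) := by exact_mod_cast le_top
  replace hαp := hαp.of_le one_le
  replace hαm := hαm.of_le one_le
  replace hρp' := hρp'.of_le one_le
  replace hρm' := hρm'.of_le one_le
  replace hu := hu.of_le one_le
  have hPp : ContDiff ℝ 1 fun q => ρp q ^ γp := hρp'.rpow_const_of_ne fun q => (hρp q).ne'
  have hPm : ContDiff ℝ 1 fun q => ρm q ^ γm := hρm'.rpow_const_of_ne fun q => (hρm q).ne'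
  have hEp : ContDiff ℝ 1 fun q => αp q * ρp q ^ γp / (γp - 1) := (hαp.mul hPp).div_const _
  have hEm : ContDiff ℝ 1 fun q => αm q * ρm q ^ γm / (γm - 1) := (hαm.mul hPm).div_const _
  set E : Pt d → ℝ := fun q => αp q * ρp q ^ γp / (γp - 1) + αm q * ρm q ^ γm / (γm - 1) with hEdef
  set Q : Pt d → ℝ := fun q => αp q * ρp q ^ γp + αm q * ρm q ^ γm with hQdef
  set R : Pt d → ℝ := fun q =>
    (1 / μbar) * (αp q * αm q) * (ρp q ^ γp - ρm q ^ γm) ^ 2 with hRdef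
  have hE : ContDiff ℝ 1 E := hEp.add hEm
  have hQ : ContDiff ℝ 1 Q := (hαp.mul hPp).add (hαm.mul hPm)
  have hR : Continuous R :=
    ((contDiff_const.mul (hαp.mul hαm)).mul ((hPp.sub hPm).pow 2)).continuous
  have hEQ : ContDiff ℝ 1 fun q => E q + Q q := hE.add hQ
  set F : Pt d → Fin d → ℝ := fun q j => (E q + Q q) * u q j with hFdef
  have hF : ContDiff ℝ 1 F := contDiff_pi.2 fun j => hEQ.mul (contDiff_pi.1 hu j)
  have hFper : ZPeriodicVec F := fun i k s x => by
    simp only [hFdef, hEdef, hQdef, pαp k s x, pαm k s x, pρp k s x, pρm k s x]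
    exact congrArg _ (pu i k s x)
  have hpoint : ∀ p, ∑ i, pd i Q p * u p i = R p + pt E p + divg F p := fun p => by
    have dd : ∀ {f : Pt d → ℝ}, ContDiff ℝ 1 f → DifferentiableAt ℝ f p := fun hf =>
      hf.differentiable one_ne_zero p
    have du : DifferentiableAt ℝ u p := hu.differentiable one_ne_zero p
    have hp := energy_balance hγp.ne' (dd hαp) (dd hρp') du (hρp p) (hmassp p)
    have hm := energy_balance hγm.ne' (dd hαm) (dd hρm') du (hρm p) (hmassm p)
    have hc := hclosure p
    simp only [mul_comm (u p _)] at hc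
    rw [pt_add_sum_pd_mul] at hc
    have hαm_eq : αm = fun q => 1 - αp q := funext fun q => by rw [← hα q]; ring
    have hcm : fderiv ℝ αm p (1, u p) = -fderiv ℝ αp p (1, u p) := by
      rw [hαm_eq, fderiv_const_sub]
      rfl
    have hdE : fderiv ℝ E p (1, u p) = fderiv ℝ (fun q => αp q * ρp q ^ γp / (γp - 1)) p (1, u p)
        + fderiv ℝ (fun q => αm q * ρm q ^ γm / (γm - 1)) p (1, u p) := by
      rw [hEdef, fderiv_fun_add (dd hEp) (dd hEm)]
      rfl
    have hdF : divg F p = fderiv ℝ E p (0, u p) + fderiv ℝ Q p (0, u p)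
        + (E p + Q p) * divg u p := by
      rw [hFdef, divg_mul (dd hEQ) du, fderiv_fun_add (dd hE) (dd hQ)]
      rfl
    have hsplit := pt_add_sum_pd_mul E p (u p)
    rw [sum_pd_mul] at hsplit
    rw [sum_pd_mul, hdF]
    rw [hcm, hc] at hm
    rw [hc] at hp
    simp only [hRdef, hEdef, hQdef] at hsplit hdE ⊢
    linear_combination -hsplit - hdE - hp - hm
  have hptc : Continuous (pt E) := hE.continuous_fderiv_apply_const _
  have hdivc : Continuous (divg F) := continuous_finsetSum _ fun i _ =>
    (contDiff_pi.1 hF i).continuous_fderiv_apply_const _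
  calc ∫ x in cell d, ∑ i, pd i Q (t, x) * u (t, x) i
      = ∫ x in cell d, (R (t, x) + pt E (t, x) + divg F (t, x)) := by simp only [hpoint]
    _ = (∫ x in cell d, R (t, x)) + ∫ x in cell d, pt E (t, x) := by
      rw [integral_add (Continuous.integrableOn_cell (f := fun p => R p + pt E p) (hR.add hptc) t)
        (hdivc.integrableOn_cell t), integral_add (hR.integrableOn_cell t)
        (hptc.integrableOn_cell t), integral_divg_eq_zero hF hFper, add_zero]
    _ = _ := by rw [← (hasDerivAt_integral_cell hE t).deriv]
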